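/- arXiv:2010.11583 — 2 statements merged into one kernel-verified Lean document; each statement's English description precedes it below -/
import Mathlib

section
/- Let (E,‖·‖_E) be a complex Banach space, p ∈ [1,∞), n ∈ ℕ and f : 𝒞_n → E. For every t > 0, ‖Δ P_t f‖_{L_p(σ_n;E)} ≤ (e^{2t} − 1)^{−1/2} ( E ‖ ∑_{i=1}^n δ_i(t) ∂_i f(ε) ‖_E^p )^{1/p}, where the expectation is over a pair (ε, ξ(t)) of independent random vectors, ε uniformly distributed on 𝒞_n, ξ(t) = (ξ_1(t),…,ξ_n(t)) with independent coordinates satisfying P(ξ_i(t) = 1) = (1+e^{−t})/2 and P(ξ_i(t) = −1) = (1−e^{−t})/2, and δ_i(t) = (ξ_i(t) − e^{−t})/√(1 − e^{−2t}). -/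
open Finset MeasureTheory Real Filter

noncomputable section

/-- The discrete hypercube `𝒞_n = {-1,1}^n`, encoded as `Fin n → Bool`. -/
abbrev Cube (n : ℕ) := Fin n → Bool

/-- The sign `±1` associated to a boolean coordinate. -/
def sgn' (b : Bool) : ℝ := if b then 1 else -1

/-- Flip the `i`-th coordinate of a point of the hypercube. -/
def flipC {n : ℕ} (i : Fin n) (x : Cube n) : Cube n := Function.update x i (!(x i))

variable {E : Type*} [NormedAddCommGroup E]

/-- Expectation `E_{σ_n} f` with respect to the uniform probability measure on the cube. -/
def cubeAvg {n : ℕ} [NormedSpace ℝ E] (f : Cube n → E) : E :=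
  (2 ^ n : ℝ)⁻¹ • ∑ x : Cube n, f x

/-- The discrete partial derivative `∂_i f (ε) = (f(ε) - f(ε with i-th coordinate flipped))/2`. -/
def dparC {n : ℕ} [NormedSpace ℝ E] (i : Fin n) (f : Cube n → E) : Cube n → E :=
  fun x => (2 : ℝ)⁻¹ • (f x - f (flipC i x))

/-- The `L_p(σ_n; E)` norm of a function on the hypercube. -/
def cubeLp {n : ℕ} (p : ℝ) (f : Cube n → E) : ℝ :=
  ((2 ^ n : ℝ)⁻¹ * ∑ x : Cube n, ‖f x‖ ^ p) ^ (1 / p)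
/-- The Walsh function `w_A(ε) = ∏_{i ∈ A} ε_i`. -/
def walshC {n : ℕ} (A : Finset (Fin n)) (x : Cube n) : ℝ := ∏ i ∈ A, sgn' (x i)

/-- The Walsh–Fourier coefficient `f̂(A) ∈ E` of `f : 𝒞_n → E`. -/
def fhatC {n : ℕ} [NormedSpace ℝ E] (f : Cube n → E) (A : Finset (Fin n)) : E :=
  (2 ^ n : ℝ)⁻¹ • ∑ x : Cube n, walshC A x • f x

/-- The negative power of the hypercube Laplacian, defined spectrally:
`Δ^{-α} f = ∑_{∅ ≠ A} |A|^{-α} f̂(A) w_A`. -/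
def negLap {n : ℕ} [NormedSpace ℝ E] (α : ℝ) (f : Cube n → E) : Cube n → E :=
  fun x => ∑ A ∈ Finset.univ.filter (fun A : Finset (Fin n) => A ≠ ∅),
    (((A.card : ℝ) ^ (-α)) * walshC A x) • fhatC f A
/-- The heat semigroup `P_t f = ∑_A e^{-t|A|} f̂(A) w_A` on the hypercube. -/
def heatC {n : ℕ} [NormedSpace ℝ E] (t : ℝ) (f : Cube n → E) : Cube n → E :=
  fun x => ∑ A : Finset (Fin n), (Real.exp (-(t * A.card)) * walshC A x) • fhatC f A

/-- The hypercube Laplacian `Δ f = ∑_i ∂_i f`. -/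
def lapC {n : ℕ} [NormedSpace ℝ E] (f : Cube n → E) : Cube n → E :=
  fun x => ∑ i, dparC i f x
theorem sgn'_mul_self (b : Bool) : sgn' b * sgn' b = 1 := by cases b <;> simp [sgn']

theorem sgn'_not (b : Bool) : sgn' (!b) = -sgn' b := by cases b <;> simp [sgn']

theorem sgn'_beq (a b : Bool) : sgn' (a == b) = sgn' a * sgn' b := by
  cases a <;> cases b <;> simp [sgn']

theorem flipC_flipC {n : ℕ} (i : Fin n) (x : Cube n) : flipC i (flipC i x) = x := by
  simp [flipC]

/-- Flipping the `i`-th coordinate, as a permutation of the hypercube. -/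
def flipEquiv {n : ℕ} (i : Fin n) : Cube n ≃ Cube n where
  toFun := flipC i
  invFun := flipC i
  left_inv := flipC_flipC i
  right_inv := flipC_flipC i

/-- Coordinatewise multiplication by a point of the hypercube, as a permutation. -/
def mulEquiv {n : ℕ} (x : Cube n) : Cube n ≃ Cube n where
  toFun ξ := fun i => ξ i == x i
  invFun ξ := fun i => ξ i == x i
  left_inv ξ := by
    funext i
    change ((ξ i == x i) == x i) = ξ i
    cases ξ i <;> cases x i <;> rfl
  right_inv ξ := by
    funext i
    change ((ξ i == x i) == x i) = ξ i
    cases ξ i <;> cases x i <;> rfl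

theorem sgn'_mulEquiv_mul {n : ℕ} (y ξ : Cube n) (i : Fin n) :
    sgn' (mulEquiv y ξ i) * sgn' (y i) = sgn' (ξ i) := by
  change sgn' (ξ i == y i) * sgn' (y i) = sgn' (ξ i)
  rw [sgn'_beq, mul_assoc, sgn'_mul_self, mul_one]

/-- The transition kernel of the heat semigroup with correlation parameter `r = e^{-t}`. -/
def heatKernel {n : ℕ} (r : ℝ) (x y : Cube n) : ℝ :=
  ∏ i, ((1 + r * (sgn' (x i) * sgn' (y i))) / 2)

theorem heatKernel_nonneg {n : ℕ} {r : ℝ} (h0 : 0 ≤ r) (h1 : r ≤ 1) (x y : Cube n) :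
    0 ≤ heatKernel r x y := by
  refine Finset.prod_nonneg fun i _ => ?_
  cases x i <;> cases y i <;> simp [sgn'] <;> linarith

theorem sum_heatKernel {n : ℕ} (r : ℝ) (x : Cube n) : ∑ y, heatKernel r x y = 1 := by
  unfold heatKernel
  rw [← Fintype.prod_sum (fun i (b : Bool) => (1 + r * (sgn' (x i) * sgn' b)) / 2)]
  refine Finset.prod_eq_one fun i _ => ?_
  simp [sgn']
  ring

theorem heatKernel_flip_flip {n : ℕ} (r : ℝ) (i : Fin n) (x y : Cube n) :
    heatKernel r (flipC i x) (flipC i y) = heatKernel r x y := by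
  refine Finset.prod_congr rfl fun j _ => ?_
  by_cases h : j = i
  · subst h
    simp [flipC, sgn'_not]
  · simp [flipC, h]

theorem heatKernel_mulEquiv {n : ℕ} (r : ℝ) (y ξ : Cube n) :
    heatKernel r (mulEquiv y ξ) y = ∏ i, ((1 + r * sgn' (ξ i)) / 2) := by
  simp only [heatKernel, sgn'_mulEquiv_mul]

theorem half_heatKernel_sub_flip {n : ℕ} {r : ℝ} (hr : 1 - r ^ 2 ≠ 0) (i : Fin n)
    (x y : Cube n) :
    2⁻¹ * (heatKernel r x y - heatKernel r (flipC i x) y) =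
      heatKernel r x y * (r / (1 - r ^ 2) * (sgn' (x i) * sgn' (y i) - r)) := by
  have key : ∀ z : Cube n, heatKernel r z y = (1 + r * (sgn' (z i) * sgn' (y i))) / 2 *
      ∏ j ∈ univ.erase i, ((1 + r * (sgn' (z j) * sgn' (y j))) / 2) := fun z =>
    (Finset.mul_prod_erase univ (fun j => (1 + r * (sgn' (z j) * sgn' (y j))) / 2)
      (mem_univ i)).symm
  have hrest : ∏ j ∈ univ.erase i, ((1 + r * (sgn' (flipC i x j) * sgn' (y j))) / 2) =
      ∏ j ∈ univ.erase i, ((1 + r * (sgn' (x j) * sgn' (y j))) / 2) :=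
    Finset.prod_congr rfl fun j hj => by simp [flipC, Finset.ne_of_mem_erase hj]
  have hflip : sgn' (flipC i x i) = -sgn' (x i) := by simp [flipC, sgn'_not]
  rw [key x, key (flipC i x), hrest, hflip, neg_mul]
  have hu : (sgn' (x i) * sgn' (y i)) ^ 2 = 1 := by
    rw [mul_pow, sq, sq, sgn'_mul_self, sgn'_mul_self, one_mul]
  generalize sgn' (x i) * sgn' (y i) = u at *
  generalize ∏ j ∈ univ.erase i, ((1 + r * (sgn' (x j) * sgn' (y j))) / 2) = Q
  field_simp
  linear_combination (-(2 * r ^ 2 * Q)) * hu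

section Real

variable [NormedSpace ℝ E]

theorem heatC_eq_sum_heatKernel {n : ℕ} (t : ℝ) (f : Cube n → E) (x : Cube n) :
    heatC t f x = ∑ y, heatKernel (Real.exp (-t)) x y • f y := by
  have hK : ∀ y : Cube n, heatKernel (Real.exp (-t)) x y =
      ∑ A : Finset (Fin n),
        Real.exp (-(t * A.card)) * walshC A x * ((2 ^ n : ℝ)⁻¹ * walshC A y) := by
    intro y
    unfold heatKernel
    rw [Finset.prod_div_distrib, Finset.prod_one_add, Finset.powerset_univ, Finset.sum_div]
    refine Finset.sum_congr rfl fun A _ => ?_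
    have he : Real.exp (-(t * A.card)) = Real.exp (-t) ^ A.card := by
      rw [← Real.exp_nat_mul]
      ring_nf
    rw [he, Finset.prod_mul_distrib, Finset.prod_mul_distrib]
    simp only [walshC, Finset.prod_const, Finset.card_univ, Fintype.card_fin]
    ring
  simp only [hK, heatC, fhatC, Finset.smul_sum, Finset.sum_smul, smul_smul]
  rw [Finset.sum_comm]

theorem dparC_sum_heatKernel {n : ℕ} {r : ℝ} (hr : 1 - r ^ 2 ≠ 0) (f : Cube n → E) (i : Fin n)
    (x : Cube n) :
    dparC i (fun z => ∑ y, heatKernel r z y • f y) x =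
      ∑ y, (heatKernel r x y * (r / (1 - r ^ 2) * (sgn' (x i) * sgn' (y i) - r))) •
        dparC i f y := by
  simp only [← half_heatKernel_sub_flip hr]
  have hre : ∑ y, (2⁻¹ * (heatKernel r x y - heatKernel r (flipC i x) y)) • f (flipC i y) =
      ∑ y, (2⁻¹ * (heatKernel r (flipC i x) y - heatKernel r x y)) • f y := by
    rw [← (flipEquiv i).sum_comp]
    refine Finset.sum_congr rfl fun y _ => ?_
    change (2⁻¹ * (heatKernel r x (flipC i y) - heatKernel r (flipC i x) (flipC i y))) •
      f (flipC i (flipC i y)) = _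
    have h := heatKernel_flip_flip r i (flipC i x) y
    rw [flipC_flipC] at h
    rw [flipC_flipC, heatKernel_flip_flip, h]
  have hR : ∑ y, (2⁻¹ * (heatKernel r x y - heatKernel r (flipC i x) y)) • dparC i f y =
      (2 : ℝ)⁻¹ • (∑ y, (2⁻¹ * (heatKernel r x y - heatKernel r (flipC i x) y)) • f y -
      ∑ y, (2⁻¹ * (heatKernel r x y - heatKernel r (flipC i x) y)) • f (flipC i y)) := by
    rw [← Finset.sum_sub_distrib, Finset.smul_sum]
    refine Finset.sum_congr rfl fun y _ => ?_
    rw [dparC, ← smul_sub, smul_comm]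
  rw [hR, hre, dparC, ← Finset.sum_sub_distrib, ← Finset.sum_sub_distrib]
  congr 1
  refine Finset.sum_congr rfl fun y _ => ?_
  rw [← sub_smul, ← sub_smul]
  congr 1
  ring

/-- The representation of `Δ P_t f` as an average of discrete derivatives of `f`, where `s` and `m`
stand for `√(1 - e^{-2t})` and `√(e^{2t} - 1)`. -/
theorem lapC_heatC_eq {n : ℕ} {t s m : ℝ} (hs : s ≠ 0) (hs2 : s ^ 2 = 1 - Real.exp (-t) ^ 2)
    (hm : s = Real.exp (-t) * m) (f : Cube n → E) (x : Cube n) :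
    lapC (heatC t f) x = m⁻¹ • ∑ y, heatKernel (Real.exp (-t)) x y •
      ∑ i, ((sgn' (x i) * sgn' (y i) - Real.exp (-t)) / s) • dparC i f y := by
  have hr : 1 - Real.exp (-t) ^ 2 ≠ 0 := hs2 ▸ pow_ne_zero 2 hs
  have hm0 : m ≠ 0 := by
    rintro rfl
    exact hs (by rw [hm, mul_zero])
  have hc : Real.exp (-t) / (1 - Real.exp (-t) ^ 2) = m⁻¹ * s⁻¹ := by
    rw [← hs2, ← mul_inv, div_eq_iff (pow_ne_zero 2 hs)]
    field_simp
    rw [hm]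
  have hh : heatC t f = fun z => ∑ y, heatKernel (Real.exp (-t)) z y • f y :=
    funext fun z => heatC_eq_sum_heatKernel t f z
  simp only [lapC, hh, dparC_sum_heatKernel hr, hc, Finset.smul_sum, smul_smul]
  rw [Finset.sum_comm]
  refine Finset.sum_congr rfl fun y _ => Finset.sum_congr rfl fun i _ => ?_
  congr 1
  ring

theorem norm_sum_heatKernel_smul_rpow_le {n : ℕ} {r p : ℝ} (h0 : 0 ≤ r) (h1 : r ≤ 1) (hp : 1 ≤ p)
    (x : Cube n) (g : Cube n → E) :
    ‖∑ y, heatKernel r x y • g y‖ ^ p ≤ ∑ y, heatKernel r x y * ‖g y‖ ^ p := by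
  have hK := heatKernel_nonneg h0 h1 x
  calc ‖∑ y, heatKernel r x y • g y‖ ^ p ≤ (∑ y, heatKernel r x y * ‖g y‖) ^ p := by
        refine Real.rpow_le_rpow (norm_nonneg _) ?_ (by linarith)
        refine (norm_sum_le _ _).trans_eq (Finset.sum_congr rfl fun y _ => ?_)
        rw [norm_smul, Real.norm_of_nonneg (hK y)]
    _ ≤ _ := Real.rpow_arith_mean_le_arith_mean_rpow _ _ _ (fun y _ => hK y)
        (sum_heatKernel r x) (fun y _ => norm_nonneg _) hp
end Real

/-- **Pointwise-in-time derivative estimate for the heat semigroup** (Proposition, eq. (37)).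
For every complex Banach space `E`, `p ∈ [1,∞)`, `f : 𝒞_n → E` and `t > 0`,
`‖Δ P_t f‖_p ≤ (e^{2t}-1)^{-1/2} (𝔼 ‖∑_i δ_i(t) ∂_i f(ε)‖^p)^{1/p}`, where `ε` is uniform on
`𝒞_n`, independent of `ξ(t)` whose coordinates are i.i.d. with `P(ξ_i(t)=±1) = (1±e^{-t})/2`,
and `δ_i(t) = (ξ_i(t) - e^{-t})/√(1-e^{-2t})`. -/
theorem heat_semigroup_derivative_bound
    (E : Type*) [NormedAddCommGroup E] [NormedSpace ℂ E] [CompleteSpace E]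
    (p : ℝ) (hp : 1 ≤ p) (n : ℕ) (f : Cube n → E) (t : ℝ) (ht : 0 < t) :
    cubeLp p (lapC (heatC t f))
      ≤ (Real.sqrt (Real.exp (2 * t) - 1))⁻¹ *
          (∑ x : Cube n, ∑ ξ : Cube n,
              ((2 ^ n : ℝ)⁻¹ * ∏ i, ((1 + Real.exp (-t) * sgn' (ξ i)) / 2)) *
                ‖∑ i, ((sgn' (ξ i) - Real.exp (-t)) / Real.sqrt (1 - Real.exp (-2 * t))) •
                    dparC i f x‖ ^ p) ^ (1 / p) := by
  set r := Real.exp (-t) with hrdef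
  set s := Real.sqrt (1 - Real.exp (-2 * t)) with hsdef
  set m := Real.sqrt (Real.exp (2 * t) - 1) with hmdef
  have hr0 : 0 < r := Real.exp_pos _
  have hr1 : r < 1 := by simpa [hrdef] using ht
  have hr2 : Real.exp (-2 * t) = r ^ 2 := by
    rw [hrdef, ← Real.exp_nat_mul]
    congr 1
    push_cast
    ring
  have hpos : 0 < 1 - r ^ 2 := by nlinarith
  have hs2 : s ^ 2 = 1 - r ^ 2 := by rw [hsdef, hr2, Real.sq_sqrt hpos.le]
  have hs : s ≠ 0 := by
    rw [hsdef, hr2]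
    exact (Real.sqrt_pos.2 hpos).ne'
  have hsm : s = r * m := by
    have he : r ^ 2 * Real.exp (2 * t) = 1 := by
      rw [← hr2, ← Real.exp_add]
      simp
    have h : 1 - Real.exp (-2 * t) = r ^ 2 * (Real.exp (2 * t) - 1) := by
      rw [hr2]
      linarith
    rw [hsdef, h, Real.sqrt_mul (sq_nonneg r), Real.sqrt_sq hr0.le]
  have hm : 0 ≤ m⁻¹ := inv_nonneg.2 (Real.sqrt_nonneg _)
  set G : Cube n → Cube n → E := fun ξ y => ∑ i, ((sgn' (ξ i) - r) / s) • dparC i f y with hG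
  set H : Cube n → Cube n → E := fun x y =>
    ∑ i, ((sgn' (x i) * sgn' (y i) - r) / s) • dparC i f y with hH
  set S := ∑ x : Cube n, ∑ ξ : Cube n,
    ((2 ^ n : ℝ)⁻¹ * ∏ i, ((1 + r * sgn' (ξ i)) / 2)) * ‖G ξ x‖ ^ p with hS
  have hS0 : 0 ≤ S := by
    refine Finset.sum_nonneg fun y _ => Finset.sum_nonneg fun ξ _ => ?_
    rw [← heatKernel_mulEquiv r y ξ]
    have := heatKernel_nonneg hr0.le hr1.le (mulEquiv y ξ) y
    positivity
  have hSH : S = (2 ^ n : ℝ)⁻¹ * ∑ x, ∑ y, heatKernel r x y * ‖H x y‖ ^ p := by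
    rw [Finset.sum_comm, Finset.mul_sum]
    refine Finset.sum_congr rfl fun y _ => ?_
    rw [← (mulEquiv y).sum_comp (fun ξ => heatKernel r ξ y * ‖H ξ y‖ ^ p), Finset.mul_sum]
    refine Finset.sum_congr rfl fun ξ _ => ?_
    simp only [heatKernel_mulEquiv, hG, hH, sgn'_mulEquiv_mul, mul_assoc]
  have hle : (2 ^ n : ℝ)⁻¹ * ∑ x, ‖lapC (heatC t f) x‖ ^ p ≤ m⁻¹ ^ p * S := by
    rw [hSH, mul_left_comm, Finset.mul_sum univ _ (m⁻¹ ^ p)]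
    refine mul_le_mul_of_nonneg_left (Finset.sum_le_sum fun x _ => ?_) (by positivity)
    rw [lapC_heatC_eq hs hs2 hsm, norm_smul, Real.norm_of_nonneg hm,
      Real.mul_rpow hm (norm_nonneg _)]
    exact mul_le_mul_of_nonneg_left
      (norm_sum_heatKernel_smul_rpow_le hr0.le hr1.le hp x (H x)) (Real.rpow_nonneg hm p)
  have hp0 : p ≠ 0 := by linarith
  calc cubeLp p (lapC (heatC t f)) ≤ (m⁻¹ ^ p * S) ^ (1 / p) :=
        Real.rpow_le_rpow (by positivity) hle (by positivity)
    _ = m⁻¹ * S ^ (1 / p) := by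
        rw [Real.mul_rpow (Real.rpow_nonneg hm p) hS0, ← Real.rpow_mul hm,
          mul_one_div_cancel hp0, Real.rpow_one]

end
end

section
/- Let E be a complex Banach space having Rademacher type 2 with constant T ∈ (0,∞). Then there exists K = K(T) ∈ (0,∞) such that for every ε ∈ (0,1), every n ∈ ℕ and every function f : 𝒞_n → E, ‖f − E_{σ_n} f‖_{L_2(σ_n;E)}^2 ≤ (K/ε) ∑_{i=1}^n ∫_0^∞ e^{−εt} ‖∂_i P_t f‖_{L_2(σ_n;E)}^2 t^{−ε} dt. -/
open Finset MeasureTheory Real Filter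

noncomputable section

variable {E : Type*} [NormedAddCommGroup E]

namespace HypercubeType

theorem sgn'_mul_self (b : Bool) : sgn' b * sgn' b = 1 := by cases b <;> simp [sgn']

/-- Coordinatewise product on the hypercube. -/
def mulC {n : ℕ} (x y : Cube n) : Cube n := fun i => x i == y i

theorem mulC_mulC {n : ℕ} (x y : Cube n) : mulC (mulC x y) y = x := by
  funext i
  simp only [mulC]
  cases x i <;> cases y i <;> rfl

theorem walshC_mulC {n : ℕ} (A : Finset (Fin n)) (x y : Cube n) :
    walshC A (mulC x y) = walshC A x * walshC A y := by
  simp only [walshC, mulC, ← Finset.prod_mul_distrib]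
  refine Finset.prod_congr rfl fun i _ => ?_
  cases x i <;> cases y i <;> simp [sgn']

theorem sgn'_mul_walshC {n : ℕ} {A : Finset (Fin n)} {i : Fin n} (hi : i ∈ A) (x : Cube n) :
    sgn' (x i) * walshC A x = walshC (A.erase i) x := by
  simp only [walshC]
  rw [← Finset.mul_prod_erase A _ hi, ← mul_assoc, sgn'_mul_self, one_mul]

theorem abs_walshC {n : ℕ} (A : Finset (Fin n)) (x : Cube n) : |walshC A x| = 1 := by
  rw [walshC, Finset.abs_prod]
  refine Finset.prod_eq_one fun i _ => ?_
  cases x i <;> simp [sgn']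

theorem sum_walshC_mul_walshC {n : ℕ} (x y : Cube n) :
    ∑ A : Finset (Fin n), walshC A x * walshC A y = if x = y then 2 ^ n else 0 := by
  simp only [walshC, ← Finset.prod_mul_distrib]
  rw [← Finset.powerset_univ, ← Finset.prod_one_add]
  split_ifs with h
  · subst h
    simp only [sgn'_mul_self]
    norm_num
  · obtain ⟨i, hi⟩ := Function.ne_iff.mp h
    refine Finset.prod_eq_zero (Finset.mem_univ i) ?_
    revert hi
    cases x i <;> cases y i <;> simp [sgn']

theorem walsh_inversion {n : ℕ} [NormedSpace ℝ E] (f : Cube n → E) (x : Cube n) :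
    ∑ A : Finset (Fin n), walshC A x • fhatC f A = f x := by
  have h2 : (2 ^ n : ℝ) ≠ 0 := by positivity
  simp only [fhatC, Finset.smul_sum, smul_smul]
  rw [Finset.sum_comm]
  simp only [← Finset.sum_smul]
  have (y : Cube n) : ∑ A : Finset (Fin n), walshC A x * ((2 ^ n : ℝ)⁻¹ * walshC A y)
      = if x = y then 1 else 0 := by
    simp only [mul_left_comm _ (2 ^ n : ℝ)⁻¹]
    rw [← Finset.mul_sum, sum_walshC_mul_walshC]
    split_ifs <;> simp [h2]
  simp [this]

theorem fhatC_empty {n : ℕ} [NormedSpace ℝ E] (f : Cube n → E) : fhatC f ∅ = cubeAvg f := by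
  simp [fhatC, cubeAvg, walshC]

/-- The density of the product measure on the hypercube whose coordinates have mean `ρ`. -/
def biasC {n : ℕ} (ρ : ℝ) (ξ : Cube n) : ℝ := ∏ i, (1 + ρ * sgn' (ξ i)) / 2

theorem biasC_nonneg {n : ℕ} {ρ : ℝ} (h0 : 0 ≤ ρ) (h1 : ρ ≤ 1) (ξ : Cube n) : 0 ≤ biasC ρ ξ := by
  refine Finset.prod_nonneg fun i _ => ?_
  cases ξ i <;> simp only [sgn'] <;> norm_num <;> linarith

theorem sum_biasC_mul_walshC {n : ℕ} (ρ : ℝ) (A : Finset (Fin n)) :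
    ∑ ξ : Cube n, biasC ρ ξ * walshC A ξ = ρ ^ A.card := by
  have (ξ : Cube n) : biasC ρ ξ * walshC A ξ
      = ∏ i, (1 + ρ * sgn' (ξ i)) / 2 * (if i ∈ A then sgn' (ξ i) else 1) := by
    rw [Finset.prod_mul_distrib, biasC, walshC, Finset.prod_ite_mem, Finset.univ_inter]
  simp only [this]
  rw [← Fintype.prod_sum (fun i b => (1 + ρ * sgn' b) / 2 * (if i ∈ A then sgn' b else 1))]
  have (i : Fin n) : ∑ b, (1 + ρ * sgn' b) / 2 * (if i ∈ A then sgn' b else 1)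
      = if i ∈ A then ρ else 1 := by
    rw [Fintype.sum_bool]
    split_ifs <;> norm_num [sgn'] <;> ring
  rw [Finset.prod_congr rfl fun i _ => this i, Finset.prod_ite_mem, Finset.univ_inter,
    Finset.prod_const]

theorem sum_biasC {n : ℕ} (ρ : ℝ) : ∑ ξ : Cube n, biasC ρ ξ = 1 := by
  simpa [walshC] using sum_biasC_mul_walshC (n := n) ρ ∅

theorem sum_biasC_mul_sgn' {n : ℕ} (ρ : ℝ) (i : Fin n) :
    ∑ ξ : Cube n, biasC ρ ξ * sgn' (ξ i) = ρ := by
  simpa [walshC] using sum_biasC_mul_walshC (n := n) ρ {i}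

theorem sum_biasC_mul_centered_mul_walshC {n : ℕ} (ρ : ℝ) {A : Finset (Fin n)} {i : Fin n}
    (hi : i ∈ A) :
    ρ * ∑ ξ : Cube n, biasC ρ ξ * ((sgn' (ξ i) - ρ) * walshC A ξ)
      = (1 - ρ ^ 2) * ρ ^ A.card := by
  have h (ξ : Cube n) : biasC ρ ξ * ((sgn' (ξ i) - ρ) * walshC A ξ)
      = biasC ρ ξ * walshC (A.erase i) ξ - ρ * (biasC ρ ξ * walshC A ξ) := by
    rw [← sgn'_mul_walshC hi]; ring
  simp only [h, Finset.sum_sub_distrib, ← Finset.mul_sum, sum_biasC_mul_walshC]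
  rw [← Finset.card_erase_add_one hi]
  ring

/-- The Walsh polynomial with coefficients `a`. -/
def walshSum {n : ℕ} [NormedSpace ℝ E] (a : Finset (Fin n) → E) (x : Cube n) : E :=
  ∑ A, walshC A x • a A

theorem walshC_flipC {n : ℕ} (A : Finset (Fin n)) (i : Fin n) (x : Cube n) :
    walshC A (flipC i x) = if i ∈ A then -walshC A x else walshC A x := by
  have hne : ∀ B : Finset (Fin n), i ∉ B → walshC B (flipC i x) = walshC B x := by
    intro B hB
    refine Finset.prod_congr rfl fun j hj => ?_
    rw [flipC, Function.update_of_ne (by rintro rfl; exact hB hj)]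
  split_ifs with hi
  · have h := hne _ (Finset.notMem_erase i A)
    simp only [walshC] at h ⊢
    rw [← Finset.mul_prod_erase A _ hi, ← Finset.mul_prod_erase A (fun j => sgn' (x j)) hi, h]
    simp only [flipC, Function.update_self]
    cases x i <;> simp [sgn']
  · exact hne A hi

theorem dparC_walshSum {n : ℕ} [NormedSpace ℝ E] (a : Finset (Fin n) → E) (i : Fin n)
    (x : Cube n) :
    dparC i (walshSum a) x = ∑ A, (if i ∈ A then walshC A x else 0) • a A := by
  simp only [dparC, walshSum, ← Finset.sum_sub_distrib, ← sub_smul, Finset.smul_sum, smul_smul,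
    walshC_flipC]
  refine Finset.sum_congr rfl fun A _ => ?_
  congr 1
  split_ifs <;> ring

/-- A probabilistic representation of `ΔP_t` applied to a Walsh polynomial, with `ρ = e^{-t}`. -/
theorem laplacian_heat_representation {n : ℕ} [NormedSpace ℝ E] (a : Finset (Fin n) → E) (ρ : ℝ)
    (x : Cube n) :
    (1 - ρ ^ 2) • ∑ A : Finset (Fin n), (A.card * ρ ^ A.card * walshC A x) • a A
      = ρ • ∑ ξ : Cube n, biasC ρ ξ •
          ∑ i, (sgn' (ξ i) - ρ) • dparC i (walshSum a) (mulC x ξ) := by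
  simp only [dparC_walshSum, Finset.smul_sum, smul_smul]
  rw [Finset.sum_comm' (t' := Finset.univ) (s' := fun _ => Finset.univ) (by simp)]
  have hswap (i : Fin n) : ∑ ξ : Cube n, ∑ A : Finset (Fin n),
      (ρ * (biasC ρ ξ * ((sgn' (ξ i) - ρ) * if i ∈ A then walshC A (mulC x ξ) else 0))) • a A
      = ∑ A : Finset (Fin n),
        (if i ∈ A then (1 - ρ ^ 2) * ρ ^ A.card * walshC A x else 0) • a A := by
    rw [Finset.sum_comm]
    refine Finset.sum_congr rfl fun A _ => ?_
    rw [← Finset.sum_smul]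
    congr 1
    split_ifs with hi
    · rw [← sum_biasC_mul_centered_mul_walshC ρ hi, Finset.mul_sum, Finset.sum_mul]
      refine Finset.sum_congr rfl fun ξ _ => ?_
      rw [walshC_mulC]; ring
    · simp
  simp only [hswap]
  rw [Finset.sum_comm]
  refine Finset.sum_congr rfl fun A _ => ?_
  rw [← Finset.sum_smul]
  congr 1
  simp only [Finset.sum_ite_mem, Finset.univ_inter, Finset.sum_const, nsmul_eq_mul]
  ring

theorem norm_sum_smul_sq_le {ι : Type*} [NormedSpace ℝ E] (s : Finset ι) {w : ι → ℝ}
    (hw : ∀ i ∈ s, 0 ≤ w i) (hw1 : ∑ i ∈ s, w i = 1) (v : ι → E) :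
    ‖∑ i ∈ s, w i • v i‖ ^ 2 ≤ ∑ i ∈ s, w i * ‖v i‖ ^ 2 := by
  have h1 : ‖∑ i ∈ s, w i • v i‖ ≤ ∑ i ∈ s, w i * ‖v i‖ := by
    refine (norm_sum_le _ _).trans (Finset.sum_le_sum fun i hi => ?_)
    rw [norm_smul, Real.norm_of_nonneg (hw i hi)]
  have h2 : (∑ i ∈ s, w i * ‖v i‖) ^ 2 ≤ (∑ i ∈ s, w i) * ∑ i ∈ s, w i * ‖v i‖ ^ 2 :=
    Finset.sum_sq_le_sum_mul_sum_of_sq_le_mul s hw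
      (fun i hi => mul_nonneg (hw i hi) (sq_nonneg _)) fun i _ => by ring_nf; rfl
  rw [hw1, one_mul] at h2
  exact (pow_le_pow_left₀ (norm_nonneg _) h1 2).trans h2

/-- Exchange the coordinates of two points of the hypercube where `r` is `false`. -/
def exchange {n : ℕ} (r : Cube n) (p : Cube n × Cube n) : Cube n × Cube n :=
  (fun i => if r i then p.1 i else p.2 i, fun i => if r i then p.2 i else p.1 i)

theorem exchange_involutive {n : ℕ} (r : Cube n) : Function.Involutive (exchange r) := by
  intro p
  ext i <;> simp only [exchange] <;> cases r i <;> simp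

theorem biasC_mul_biasC_exchange {n : ℕ} (ρ : ℝ) (r : Cube n) (p : Cube n × Cube n) :
    biasC ρ (exchange r p).1 * biasC ρ (exchange r p).2 = biasC ρ p.1 * biasC ρ p.2 := by
  simp only [biasC, ← Finset.prod_mul_distrib, exchange]
  refine Finset.prod_congr rfl fun i _ => ?_
  cases r i <;> simp [mul_comm]

theorem sgn'_sub_sgn'_exchange {n : ℕ} (r : Cube n) (p : Cube n × Cube n) (i : Fin n) :
    sgn' ((exchange r p).1 i) - sgn' ((exchange r p).2 i)
      = sgn' (r i) * (sgn' (p.1 i) - sgn' (p.2 i)) := by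
  simp only [exchange]
  cases r i <;> simp [sgn']

theorem sum_biasC_mul_biasC_mul_sub_sq {n : ℕ} (ρ : ℝ) (i : Fin n) :
    ∑ p : Cube n × Cube n, biasC ρ p.1 * biasC ρ p.2 * (sgn' (p.1 i) - sgn' (p.2 i)) ^ 2
      = 2 * (1 - ρ ^ 2) := by
  have h (p : Cube n × Cube n) :
      biasC ρ p.1 * biasC ρ p.2 * (sgn' (p.1 i) - sgn' (p.2 i)) ^ 2
        = 2 * (biasC ρ p.1 * biasC ρ p.2)
          - 2 * ((biasC ρ p.1 * sgn' (p.1 i)) * (biasC ρ p.2 * sgn' (p.2 i))) := by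
    linear_combination biasC ρ p.1 * biasC ρ p.2 *
      (sgn'_mul_self (p.1 i) + sgn'_mul_self (p.2 i))
  simp only [h, Finset.sum_sub_distrib, ← Finset.mul_sum, Fintype.sum_prod_type,
    ← Finset.sum_mul, sum_biasC, sum_biasC_mul_sgn']
  ring

/-- The Rademacher type 2 inequality with constant `T`. -/
def RademacherTypeTwo (E : Type*) [NormedAddCommGroup E] [NormedSpace ℝ E] (T : ℝ) : Prop :=
  ∀ (m : ℕ) (v : Fin m → E),
    (2 ^ m : ℝ)⁻¹ * ∑ ε : Cube m, ‖∑ i, sgn' (ε i) • v i‖ ^ 2 ≤ T ^ 2 * ∑ i, ‖v i‖ ^ 2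

theorem RademacherTypeTwo.sum_biasC_mul_norm_sq_le [NormedSpace ℝ E] {T : ℝ}
    (hE : RademacherTypeTwo E T) {n : ℕ} {ρ : ℝ} (h0 : 0 ≤ ρ) (h1 : ρ ≤ 1) (v : Fin n → E) :
    ∑ ξ : Cube n, biasC ρ ξ * ‖∑ i, (sgn' (ξ i) - ρ) • v i‖ ^ 2
      ≤ 2 * (1 - ρ ^ 2) * T ^ 2 * ∑ i, ‖v i‖ ^ 2 := by
  have hb := biasC_nonneg (n := n) h0 h1
  set D : Cube n × Cube n → Fin n → ℝ := fun p i => sgn' (p.1 i) - sgn' (p.2 i) with hD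
  set W : Cube n × Cube n → ℝ := fun p => biasC ρ p.1 * biasC ρ p.2 with hW
  have hWnn (p) : 0 ≤ W p := mul_nonneg (hb _) (hb _)
  have hind : ∑ ξ : Cube n, biasC ρ ξ * ‖∑ i, (sgn' (ξ i) - ρ) • v i‖ ^ 2
      ≤ ∑ p, W p * ‖∑ i, D p i • v i‖ ^ 2 := by
    rw [Fintype.sum_prod_type]
    refine Finset.sum_le_sum fun ξ _ => ?_
    have hmean : ∑ i, (sgn' (ξ i) - ρ) • v i
        = ∑ η : Cube n, biasC ρ η • ∑ i, (sgn' (ξ i) - sgn' (η i)) • v i := by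
      simp only [Finset.smul_sum, smul_smul]
      rw [Finset.sum_comm]
      refine Finset.sum_congr rfl fun i _ => ?_
      rw [← Finset.sum_smul]
      simp only [mul_sub, Finset.sum_sub_distrib, ← Finset.sum_mul, sum_biasC,
        sum_biasC_mul_sgn', one_mul]
    rw [hmean]
    refine (mul_le_mul_of_nonneg_left
      (norm_sum_smul_sq_le _ (fun η _ => hb η) (sum_biasC ρ) _) (hb ξ)).trans_eq ?_
    simp only [Finset.mul_sum, hW, hD, mul_assoc]
  have hsymm (r : Cube n) : ∑ p, W p * ‖∑ i, D p i • v i‖ ^ 2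
      = ∑ p, W p * ‖∑ i, sgn' (r i) • D p i • v i‖ ^ 2 := by
    rw [← Equiv.sum_comp (exchange_involutive r).toPerm]
    refine Finset.sum_congr rfl fun p _ => ?_
    simp only [Function.Involutive.coe_toPerm, hW, hD, biasC_mul_biasC_exchange,
      sgn'_sub_sgn'_exchange, smul_smul]
  have havg : ∑ p, W p * ‖∑ i, D p i • v i‖ ^ 2
      = ∑ p, W p * ((2 ^ n : ℝ)⁻¹ * ∑ r : Cube n, ‖∑ i, sgn' (r i) • D p i • v i‖ ^ 2) := by
    have hconst : ∑ p, W p * ‖∑ i, D p i • v i‖ ^ 2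
        = (2 ^ n : ℝ)⁻¹ * ∑ _r : Cube n, ∑ p, W p * ‖∑ i, D p i • v i‖ ^ 2 := by
      simp
    rw [hconst, Finset.sum_congr rfl fun r _ => hsymm r, Finset.sum_comm, Finset.mul_sum]
    refine Finset.sum_congr rfl fun p _ => ?_
    rw [← Finset.mul_sum]; ring
  calc _ ≤ _ := hind
    _ = _ := havg
    _ ≤ ∑ p, W p * (T ^ 2 * ∑ i, ‖D p i • v i‖ ^ 2) :=
        Finset.sum_le_sum fun p _ => mul_le_mul_of_nonneg_left (hE n _) (hWnn p)
    _ = T ^ 2 * ∑ i, (∑ p, W p * D p i ^ 2) * ‖v i‖ ^ 2 := by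
        simp only [Finset.mul_sum, Finset.sum_mul, norm_smul, mul_pow, Real.norm_eq_abs, sq_abs]
        rw [Finset.sum_comm]
        refine Finset.sum_congr rfl fun i _ => Finset.sum_congr rfl fun p _ => by ring
    _ = _ := by
        simp only [hW, hD, sum_biasC_mul_biasC_mul_sub_sq, ← Finset.mul_sum]
        ring

/-- The `L_2` bound for `ΔP_t` applied to a Walsh polynomial, with `ρ = e^{-t}`. -/
theorem RademacherTypeTwo.sum_norm_laplacian_heat_sq_le [NormedSpace ℝ E] {T : ℝ}
    (hE : RademacherTypeTwo E T) {n : ℕ} {ρ : ℝ} (h0 : 0 ≤ ρ) (h1 : ρ < 1)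
    (a : Finset (Fin n) → E) :
    (1 - ρ ^ 2) * ∑ x : Cube n,
        ‖∑ A : Finset (Fin n), (A.card * ρ ^ A.card * walshC A x) • a A‖ ^ 2
      ≤ 2 * T ^ 2 * ρ ^ 2 * ∑ i, ∑ x, ‖dparC i (walshSum a) x‖ ^ 2 := by
  have hb := biasC_nonneg (n := n) h0 h1.le
  have hpos : 0 < 1 - ρ ^ 2 := by nlinarith
  have hpt (x : Cube n) : (1 - ρ ^ 2) ^ 2 *
        ‖∑ A : Finset (Fin n), (A.card * ρ ^ A.card * walshC A x) • a A‖ ^ 2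
      ≤ ρ ^ 2 * ∑ ξ : Cube n, biasC ρ ξ *
          ‖∑ i, (sgn' (ξ i) - ρ) • dparC i (walshSum a) (mulC x ξ)‖ ^ 2 := by
    have h := congrArg (fun e => ‖e‖ ^ 2) (laplacian_heat_representation a ρ x)
    simp only [norm_smul, mul_pow, Real.norm_eq_abs, sq_abs] at h
    rw [h]
    exact mul_le_mul_of_nonneg_left
      (norm_sum_smul_sq_le _ (fun ξ _ => hb ξ) (sum_biasC ρ) _) (sq_nonneg ρ)
  have hshift (ξ : Cube n) (g : Cube n → ℝ) : ∑ x, g (mulC x ξ) = ∑ x, g x :=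
    Equiv.sum_comp (Function.Involutive.toPerm (fun x => mulC x ξ)
      fun x => mulC_mulC x ξ) g
  have hsum : (1 - ρ ^ 2) ^ 2 * ∑ x : Cube n,
        ‖∑ A : Finset (Fin n), (A.card * ρ ^ A.card * walshC A x) • a A‖ ^ 2
      ≤ ρ ^ 2 * (2 * (1 - ρ ^ 2) * T ^ 2 * ∑ i, ∑ x, ‖dparC i (walshSum a) x‖ ^ 2) := by
    rw [Finset.mul_sum]
    refine (Finset.sum_le_sum fun x _ => hpt x).trans ?_
    rw [← Finset.mul_sum, Finset.sum_comm]
    refine mul_le_mul_of_nonneg_left ?_ (sq_nonneg ρ)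
    simp only [← Finset.mul_sum]
    rw [Finset.sum_congr rfl fun ξ _ => congrArg (biasC ρ ξ * ·)
      (hshift ξ fun y => ‖∑ i, (sgn' (ξ i) - ρ) • dparC i (walshSum a) y‖ ^ 2)]
    simp only [Finset.mul_sum]
    rw [Finset.sum_comm, Finset.sum_comm (s := (Finset.univ : Finset (Fin n)))]
    refine Finset.sum_le_sum fun y _ => ?_
    rw [← Finset.mul_sum]
    exact hE.sum_biasC_mul_norm_sq_le h0 h1.le _
  refine le_of_mul_le_mul_left ?_ hpos
  linarith

theorem sq_integral_le_integral_mul_integral {α : Type*} [MeasurableSpace α] {μ : Measure α}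
    {h φ q : α → ℝ} (hh : Integrable h μ) (hφ : Integrable φ μ) (hq : Integrable q μ)
    (hpos : ∀ᵐ t ∂μ, 0 < φ t) (hle : ∀ᵐ t ∂μ, h t ^ 2 ≤ φ t * q t) :
    (∫ t, h t ∂μ) ^ 2 ≤ (∫ t, φ t ∂μ) * ∫ t, q t ∂μ := by
  have key (s : ℝ) : 0 ≤ (∫ t, φ t ∂μ) * (s * s) + (-2 * ∫ t, h t ∂μ) * s + ∫ t, q t ∂μ := by
    have hint : ∫ t, (φ t * (s * s) + (-2 * h t) * s + q t) ∂μ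
        = (∫ t, φ t ∂μ) * (s * s) + (-2 * ∫ t, h t ∂μ) * s + ∫ t, q t ∂μ := by
      have hsum : Integrable (fun t => φ t * (s * s) + (-2 * h t) * s) μ :=
        (hφ.mul_const _).add ((hh.const_mul _).mul_const _)
      rw [integral_add hsum hq, integral_add (hφ.mul_const _) ((hh.const_mul _).mul_const _), integral_mul_const,
        integral_mul_const, integral_const_mul]
    rw [← hint]
    refine integral_nonneg_of_ae ?_
    filter_upwards [hpos, hle] with t h1 h2
    refine nonneg_of_mul_nonneg_right (a := φ t) ?_ h1
    nlinarith [sq_nonneg (h t - s * φ t)]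
  have := discrim_le_zero key
  simp only [discrim] at this
  linarith

theorem Gamma_le_inv {s : ℝ} (h0 : 0 < s) (h1 : s ≤ 1) : Real.Gamma s ≤ 1 / s := by
  have h := Real.convexOn_Gamma.2 (show (1 : ℝ) ∈ Set.Ioi 0 by simp)
    (show (2 : ℝ) ∈ Set.Ioi 0 by simp) (show 0 ≤ 1 - s by linarith) h0.le (by ring)
  rw [show (1 - s) • (1 : ℝ) + s • (2 : ℝ) = s + 1 by simp; ring, Real.Gamma_add_one h0.ne'] at h
  simp only [Real.Gamma_one, Real.Gamma_two, smul_eq_mul] at h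
  rw [le_div_iff₀ h0]
  linarith

theorem integrableOn_rpow_mul_exp_neg_mul {s b : ℝ} (hs : -1 < s) (hb : 0 < b) :
    IntegrableOn (fun t : ℝ => t ^ s * Real.exp (-(b * t))) (Set.Ioi 0) := by
  simpa using integrableOn_rpow_mul_exp_neg_mul_rpow hs one_pos hb

theorem integral_rpow_mul_exp_neg_half_le {ε : ℝ} (h0 : 0 < ε) (h1 : ε < 1) :
    ∫ t in Set.Ioi (0 : ℝ), t ^ (ε - 1) * Real.exp (-(1 / 2 * t)) ≤ 2 / ε := by
  rw [Real.integral_rpow_mul_exp_neg_mul_Ioi h0 (by norm_num)]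
  have h2 : (1 / (1 / 2) : ℝ) ^ ε ≤ 2 := by
    calc (1 / (1 / 2) : ℝ) ^ ε ≤ (1 / (1 / 2) : ℝ) ^ (1 : ℝ) :=
          Real.rpow_le_rpow_of_exponent_le (by norm_num) h1.le
      _ = 2 := by norm_num
  calc _ ≤ 2 * (1 / ε) := mul_le_mul h2 (Gamma_le_inv h0 h1.le) (Real.Gamma_pos_of_pos h0).le
        (by norm_num)
    _ = 2 / ε := by ring

theorem exp_weight_le {ε t : ℝ} (h1 : ε < 1) (ht : 0 < t) :
    Real.exp (-t) ^ 2 ≤ 2 * (1 - Real.exp (-t) ^ 2) *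
      (t ^ (ε - 1) * Real.exp (-(1 / 2 * t))) * (Real.exp (-(ε * t)) * t ^ (-ε)) := by
  have hpow : t ^ (ε - 1) * t ^ (-ε) = t⁻¹ := by
    rw [← Real.rpow_add ht, show ε - 1 + -ε = -1 by ring, Real.rpow_neg_one]
  set u := Real.exp (-(1 / 2 * t)) with hu
  have hu0 : 0 < u := Real.exp_pos _
  have hu1 : u ≤ 1 := Real.exp_le_one_iff.mpr (by linarith)
  have hρ : Real.exp (-t) = u ^ 2 := by rw [hu, ← Real.exp_nat_mul]; congr 1; push_cast; ring
  have hε : u ^ 2 ≤ Real.exp (-(ε * t)) := by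
    rw [← hρ]; exact Real.exp_le_exp.mpr (by nlinarith)
  have htu : t * u ≤ 2 * (1 - u) := by
    have h := Real.add_one_le_exp (1 / 2 * t)
    have h' : Real.exp (1 / 2 * t) * u = 1 := by rw [hu, ← Real.exp_add]; simp
    nlinarith
  have hu4 : 1 - u ≤ 1 - (u ^ 2) ^ 2 := by
    have : (u ^ 2) ^ 2 ≤ u := by
      rw [← pow_mul]; exact pow_le_of_le_one hu0.le hu1 (by norm_num)
    linarith
  rw [hρ]
  calc (u ^ 2) ^ 2 = t⁻¹ * (t * u) * (u * u ^ 2) := by field_simp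
    _ ≤ t⁻¹ * (2 * (1 - (u ^ 2) ^ 2)) * (u * Real.exp (-(ε * t))) := by
        have : 0 ≤ 1 - (u ^ 2) ^ 2 := by linarith
        exact mul_le_mul (mul_le_mul_of_nonneg_left (by linarith) (by positivity))
          (mul_le_mul_of_nonneg_left hε hu0.le) (by positivity) (by positivity)
    _ = _ := by rw [← hpow]; ring

theorem heatC_eq_walshSum {n : ℕ} [NormedSpace ℝ E] (f : Cube n → E) (t : ℝ) :
    heatC t f = walshSum fun A => Real.exp (-(t * A.card)) • fhatC f A := by
  funext x
  simp only [heatC, walshSum, smul_smul, mul_comm]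

theorem continuous_dparC_heatC {n : ℕ} [NormedSpace ℝ E] (f : Cube n → E) (i : Fin n)
    (x : Cube n) : Continuous fun t => dparC i (heatC t f) x := by
  simp only [dparC, heatC]
  fun_prop

theorem norm_dparC_heatC_le {n : ℕ} [NormedSpace ℝ E] (f : Cube n → E) (i : Fin n)
    (x : Cube n) {t : ℝ} (ht : 0 ≤ t) :
    ‖dparC i (heatC t f) x‖ ≤ ∑ A, ‖fhatC f A‖ := by
  rw [heatC_eq_walshSum, dparC_walshSum]
  refine (norm_sum_le _ _).trans (Finset.sum_le_sum fun A _ => ?_)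
  have h1 : Real.exp (-(t * A.card)) ≤ 1 := Real.exp_le_one_iff.mpr (by simp; positivity)
  have h2 : |if i ∈ A then walshC A x else 0| ≤ 1 := by
    split_ifs
    · exact (abs_walshC A x).le
    · simp
  rw [norm_smul, norm_smul, Real.norm_eq_abs, Real.norm_of_nonneg (Real.exp_pos _).le]
  calc _ ≤ 1 * (1 * ‖fhatC f A‖) := by gcongr
    _ = _ := by ring

theorem cubeLp_two_sq {n : ℕ} (g : Cube n → E) :
    cubeLp 2 g ^ 2 = (2 ^ n : ℝ)⁻¹ * ∑ x, ‖g x‖ ^ 2 := by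
  rw [cubeLp, ← Real.rpow_natCast, ← Real.rpow_mul (by positivity)]
  simp

theorem integrableOn_exp_mul_norm_dparC_heatC_sq {n : ℕ} [NormedSpace ℝ E] (f : Cube n → E)
    (i : Fin n) (x : Cube n) {ε : ℝ} (h0 : 0 < ε) (h1 : ε < 1) :
    IntegrableOn (fun t => Real.exp (-(ε * t)) * ‖dparC i (heatC t f) x‖ ^ 2 * t ^ (-ε))
      (Set.Ioi 0) := by
  have h := integrableOn_rpow_mul_exp_neg_mul (s := -ε) (b := ε) (by linarith) h0
  have hb : ∀ᵐ t ∂(volume.restrict (Set.Ioi (0 : ℝ))),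
      ‖‖dparC i (heatC t f) x‖ ^ 2‖ ≤ (∑ A, ‖fhatC f A‖) ^ 2 := by
    filter_upwards [ae_restrict_mem measurableSet_Ioi] with t ht
    rw [norm_pow, norm_norm]
    exact pow_le_pow_left₀ (norm_nonneg _) (norm_dparC_heatC_le f i x (le_of_lt ht)) 2
  refine (h.mul_bdd ((continuous_dparC_heatC f i x).norm.pow 2).aestronglyMeasurable hb).congr
    (Filter.Eventually.of_forall fun t => ?_)
  simp only [Pi.pow_apply]
  ring

/-- The function `t ↦ 2 Δ P_{2t} f (x)`, whose integral over `(0, ∞)` is `f x - 𝔼 f`. -/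
def lapHeat {n : ℕ} [NormedSpace ℝ E] (f : Cube n → E) (x : Cube n) (t : ℝ) : E :=
  ∑ A : Finset (Fin n), (2 * A.card * Real.exp (-(2 * A.card) * t)) • walshC A x • fhatC f A

theorem continuous_lapHeat {n : ℕ} [NormedSpace ℝ E] (f : Cube n → E) (x : Cube n) :
    Continuous (lapHeat f x) := by
  unfold lapHeat
  fun_prop

theorem integrableOn_mul_exp_neg_mul {c : ℝ} (hc : 0 ≤ c) :
    IntegrableOn (fun t : ℝ => c * Real.exp (-c * t)) (Set.Ioi 0) := by
  rcases hc.eq_or_lt with rfl | hc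
  · simp
  · exact (integrableOn_exp_mul_Ioi (neg_neg_of_pos hc) 0).const_mul c

theorem integral_mul_exp_neg_mul {c : ℝ} (hc : 0 < c) :
    ∫ t in Set.Ioi (0 : ℝ), c * Real.exp (-c * t) = 1 := by
  rw [integral_const_mul, integral_exp_mul_Ioi (neg_neg_of_pos hc)]
  simp [hc.ne']

theorem integrableOn_lapHeat {n : ℕ} [NormedSpace ℝ E] (f : Cube n → E) (x : Cube n) :
    IntegrableOn (lapHeat f x) (Set.Ioi 0) :=
  integrable_finsetSum _ fun A _ =>
    (integrableOn_mul_exp_neg_mul (c := 2 * A.card) (by positivity)).smul_const _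

theorem integral_lapHeat {n : ℕ} [NormedSpace ℝ E] [CompleteSpace E] (f : Cube n → E)
    (x : Cube n) : ∫ t in Set.Ioi (0 : ℝ), lapHeat f x t = f x - cubeAvg f := by
  unfold lapHeat
  rw [integral_finsetSum _ fun A _ =>
    (integrableOn_mul_exp_neg_mul (c := 2 * A.card) (by positivity)).smul_const _]
  simp only [integral_smul_const]
  rw [← walsh_inversion f x, ← fhatC_empty, eq_sub_iff_add_eq,
    ← Finset.add_sum_erase _ _ (Finset.mem_univ (∅ : Finset (Fin n))),
    ← Finset.add_sum_erase _ (fun A => walshC A x • fhatC f A)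
      (Finset.mem_univ (∅ : Finset (Fin n))), add_comm]
  congr 1
  · simp [walshC]
  · simp only [Finset.card_empty, CharP.cast_eq_zero, mul_zero, zero_mul, integral_zero,
      zero_smul, zero_add]
    refine Finset.sum_congr rfl fun A hA => ?_
    have hcard : 0 < A.card :=
      Finset.card_pos.mpr (Finset.nonempty_iff_ne_empty.mpr (Finset.ne_of_mem_erase hA))
    rw [integral_mul_exp_neg_mul (by positivity), one_smul]

theorem RademacherTypeTwo.sum_norm_lapHeat_sq_le [NormedSpace ℝ E] {T : ℝ}
    (hE : RademacherTypeTwo E T) {n : ℕ} (f : Cube n → E) {t : ℝ} (ht : 0 < t) :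
    (1 - Real.exp (-t) ^ 2) * ∑ x, ‖lapHeat f x t‖ ^ 2
      ≤ 8 * T ^ 2 * Real.exp (-t) ^ 2 * ∑ i, ∑ x, ‖dparC i (heatC t f) x‖ ^ 2 := by
  have h := hE.sum_norm_laplacian_heat_sq_le (Real.exp_pos (-t)).le
    (Real.exp_lt_one_iff.mpr (neg_neg_of_pos ht)) fun A => Real.exp (-(t * A.card)) • fhatC f A
  rw [← heatC_eq_walshSum] at h
  have hF (x : Cube n) : lapHeat f x t = (2 : ℝ) • ∑ A : Finset (Fin n),
      (A.card * Real.exp (-t) ^ A.card * walshC A x) • Real.exp (-(t * A.card)) • fhatC f A := by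
    rw [lapHeat, Finset.smul_sum]
    refine Finset.sum_congr rfl fun A _ => ?_
    simp only [smul_smul]
    congr 1
    rw [← Real.exp_nat_mul, show -(2 * (A.card : ℝ)) * t = A.card * -t + -(t * A.card) by ring,
      Real.exp_add]
    ring
  simp only [hF, norm_smul, mul_pow, ← Finset.mul_sum]
  norm_num
  linarith

theorem RademacherTypeTwo.cubeLp_sub_cubeAvg_sq_le [NormedSpace ℝ E] [CompleteSpace E] {T : ℝ}
    (hE : RademacherTypeTwo E T) {ε : ℝ} (h0 : 0 < ε) (h1 : ε < 1) {n : ℕ} (f : Cube n → E) :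
    cubeLp 2 (fun x => f x - cubeAvg f) ^ 2
      ≤ (32 * T ^ 2 / ε) * ∑ i : Fin n, ∫ t in Set.Ioi (0 : ℝ),
          Real.exp (-(ε * t)) * cubeLp 2 (dparC i (heatC t f)) ^ 2 * t ^ (-ε) := by
  set φ : ℝ → ℝ := fun t => t ^ (ε - 1) * Real.exp (-(1 / 2 * t)) with hφ
  set S : ℝ → ℝ := fun t => ∑ i, ∑ x,
    Real.exp (-(ε * t)) * ‖dparC i (heatC t f) x‖ ^ 2 * t ^ (-ε) with hS
  have hφint : IntegrableOn φ (Set.Ioi 0) :=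
    integrableOn_rpow_mul_exp_neg_mul (by linarith) (by norm_num)
  have hφpos : ∀ t ∈ Set.Ioi (0 : ℝ), 0 < φ t := fun t ht =>
    mul_pos (Real.rpow_pos_of_pos ht _) (Real.exp_pos _)
  have hSint : IntegrableOn S (Set.Ioi 0) :=
    integrable_finsetSum _ fun i _ => integrable_finsetSum _ fun x _ =>
      integrableOn_exp_mul_norm_dparC_heatC_sq f i x h0 h1
  have hbound : ∀ t ∈ Set.Ioi (0 : ℝ), ∑ x, ‖lapHeat f x t‖ ^ 2 / φ t ≤ 16 * T ^ 2 * S t := by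
    intro t ht
    have hρ : 0 < 1 - Real.exp (-t) ^ 2 := by
      have := Real.exp_lt_one_iff.mpr (neg_neg_of_pos ht)
      have := Real.exp_pos (-t)
      nlinarith
    have hSt : S t = Real.exp (-(ε * t)) * t ^ (-ε) *
        ∑ i, ∑ x, ‖dparC i (heatC t f) x‖ ^ 2 := by
      simp only [hS, Finset.mul_sum]
      exact Finset.sum_congr rfl fun i _ => Finset.sum_congr rfl fun x _ => by ring
    rw [← Finset.sum_div, div_le_iff₀ (hφpos t ht), hSt]
    refine le_of_mul_le_mul_left ((hE.sum_norm_lapHeat_sq_le f ht).trans ?_) hρ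
    calc _ = 8 * T ^ 2 * (∑ i, ∑ x, ‖dparC i (heatC t f) x‖ ^ 2) * Real.exp (-t) ^ 2 := by ring
      _ ≤ 8 * T ^ 2 * (∑ i, ∑ x, ‖dparC i (heatC t f) x‖ ^ 2) * _ :=
          mul_le_mul_of_nonneg_left (exp_weight_le h1 ht) (by positivity)
      _ = _ := by simp only [hφ]; ring
  have hqint (x : Cube n) :
      IntegrableOn (fun t => ‖lapHeat f x t‖ ^ 2 / φ t) (Set.Ioi 0) := by
    refine (hSint.const_mul (16 * T ^ 2)).mono' ?_ ?_
    · exact (((continuous_lapHeat f x).norm.pow 2).measurable.div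
        (by simp only [hφ]; fun_prop)).aestronglyMeasurable
    · filter_upwards [ae_restrict_mem measurableSet_Ioi] with t ht
      have hnn (y : Cube n) : 0 ≤ ‖lapHeat f y t‖ ^ 2 / φ t :=
        div_nonneg (sq_nonneg _) (hφpos t ht).le
      rw [Real.norm_of_nonneg (hnn x)]
      exact (Finset.single_le_sum (f := fun y => ‖lapHeat f y t‖ ^ 2 / φ t)
        (fun y _ => hnn y) (Finset.mem_univ x)).trans (hbound t ht)
  have hpt (x : Cube n) : ‖f x - cubeAvg f‖ ^ 2
      ≤ 2 / ε * ∫ t in Set.Ioi (0 : ℝ), ‖lapHeat f x t‖ ^ 2 / φ t := by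
    rw [← integral_lapHeat f x]
    refine (pow_le_pow_left₀ (norm_nonneg _) (norm_integral_le_integral_norm _) 2).trans ?_
    refine (sq_integral_le_integral_mul_integral (integrableOn_lapHeat f x).norm hφint (hqint x)
      ((ae_restrict_mem measurableSet_Ioi).mono hφpos) ?_).trans ?_
    · filter_upwards [ae_restrict_mem measurableSet_Ioi] with t ht
      rw [mul_div_cancel₀ _ (hφpos t ht).ne']
    · refine mul_le_mul_of_nonneg_right (integral_rpow_mul_exp_neg_half_le h0 h1) ?_
      exact setIntegral_nonneg measurableSet_Ioi fun t ht =>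
        div_nonneg (sq_nonneg _) (hφpos t ht).le
  have hsum : ∑ x, ‖f x - cubeAvg f‖ ^ 2
      ≤ 32 * T ^ 2 / ε * ∫ t in Set.Ioi (0 : ℝ), S t := by
    calc _ ≤ ∑ x, 2 / ε * ∫ t in Set.Ioi (0 : ℝ), ‖lapHeat f x t‖ ^ 2 / φ t :=
          Finset.sum_le_sum fun x _ => hpt x
      _ = 2 / ε * ∫ t in Set.Ioi (0 : ℝ), ∑ x, ‖lapHeat f x t‖ ^ 2 / φ t := by
          rw [← Finset.mul_sum, integral_finsetSum _ fun x _ => hqint x]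
      _ ≤ 2 / ε * ∫ t in Set.Ioi (0 : ℝ), 16 * T ^ 2 * S t := by
          refine mul_le_mul_of_nonneg_left ?_ (by positivity)
          exact setIntegral_mono_on (integrable_finsetSum _ fun x _ => hqint x)
            (hSint.const_mul _) measurableSet_Ioi hbound
      _ = _ := by rw [integral_const_mul]; ring
  have hRHS : ∑ i : Fin n, ∫ t in Set.Ioi (0 : ℝ),
        Real.exp (-(ε * t)) * cubeLp 2 (dparC i (heatC t f)) ^ 2 * t ^ (-ε)
      = (2 ^ n : ℝ)⁻¹ * ∫ t in Set.Ioi (0 : ℝ), S t := by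
    have hinner (i : Fin n) := integrable_finsetSum (Finset.univ : Finset (Cube n)) fun x _ =>
      integrableOn_exp_mul_norm_dparC_heatC_sq f i x h0 h1
    rw [integral_finsetSum _ fun i _ => hinner i, Finset.mul_sum]
    refine Finset.sum_congr rfl fun i _ => ?_
    rw [← integral_const_mul]
    congr 1
    funext t
    rw [cubeLp_two_sq, ← Finset.sum_mul, ← Finset.mul_sum]
    ring
  rw [cubeLp_two_sq, hRHS]
  calc _ ≤ (2 ^ n : ℝ)⁻¹ * (32 * T ^ 2 / ε * ∫ t in Set.Ioi (0 : ℝ), S t) :=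
        mul_le_mul_of_nonneg_left hsum (by positivity)
    _ = _ := by ring

end HypercubeType

/-- **Semigroup influence bound under Rademacher type 2** (Lemma, eq. (35)).
If `E` is a complex Banach space of Rademacher type 2 with constant `T`, there is
`K = K(T) ∈ (0,∞)` such that for every `ε ∈ (0,1)` and every `f : 𝒞_n → E`,
`‖f - E f‖₂² ≤ (K/ε) ∑_i ∫_0^∞ e^{-εt} ‖∂_i P_t f‖₂² t^{-ε} dt`. -/
theorem semigroup_influence_bound_rademacher_type_two
    (E : Type*) [NormedAddCommGroup E] [NormedSpace ℂ E] [CompleteSpace E]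
    (T : ℝ) (hT : 0 < T)
    (htype : ∀ (m : ℕ) (v : Fin m → E),
      (2 ^ m : ℝ)⁻¹ * ∑ ε : Cube m, ‖∑ i, sgn' (ε i) • v i‖ ^ 2
        ≤ T ^ 2 * ∑ i, ‖v i‖ ^ 2) :
    ∃ K : ℝ, 0 < K ∧ ∀ ε ∈ Set.Ioo (0 : ℝ) 1, ∀ (n : ℕ) (f : Cube n → E),
      cubeLp 2 (fun x => f x - cubeAvg f) ^ 2
        ≤ (K / ε) * ∑ i : Fin n,
            ∫ t in Set.Ioi (0 : ℝ),
              Real.exp (-(ε * t)) * cubeLp 2 (dparC i (heatC t f)) ^ 2 * t ^ (-ε) := by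
  refine ⟨32 * T ^ 2, by positivity, fun ε hε n f => ?_⟩
  exact HypercubeType.RademacherTypeTwo.cubeLp_sub_cubeAvg_sq_le htype hε.1 hε.2 f

end
end
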